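/- If R is a principal ideal domain and (s₁,s₂,r,h) ∈ F₀, then h > k₀²/(2k). -/

import Mathlib

noncomputable section

open scoped Classical
open MeasureTheory

namespace Hilbert

/-- `k₀ = 2` if `k ≡ 1 (mod 4)` and `k₀ = 1` otherwise. -/
def k0 (k : ℕ) : ℝ := if k % 4 = 1 then 2 else 1

/-- `ω = (1 + √k)/k₀`. -/
def omg (k : ℕ) : ℝ := (1 + Real.sqrt k) / k0 k

/-- `ω' = (1 - √k)/k₀`, the algebraic conjugate of `ω`. -/
def omg' (k : ℕ) : ℝ := (1 - Real.sqrt k) / k0 k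

/-- The ring `R = ℤ[ω]`, realized inside `ℝ × ℝ` via the pair of real embeddings
`α ↦ (α, α')` of `K = ℚ(√k)`. -/
def R (k : ℕ) : Subring (ℝ × ℝ) := Subring.closure {(omg k, omg' k)}

/-- The ambient space `ℝ⁴`, with coordinates `(x₁, x₂, y₁, y₂)`. -/
abbrev Pt : Type := ℝ × ℝ × ℝ × ℝ

def x1 (p : Pt) : ℝ := p.1
def x2 (p : Pt) : ℝ := p.2.1
def y1 (p : Pt) : ℝ := p.2.2.1
def y2 (p : Pt) : ℝ := p.2.2.2

/-- `H² × H²`, identified with an open subset of `ℝ⁴`. -/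
def HH : Set Pt := {p | 0 < y1 p ∧ 0 < y2 p}

/-- The coordinate `s₁`, determined by `x₁ = s₁ + s₂ ω`, `x₂ = s₁ + s₂ ω'`. -/
def s1 (k : ℕ) (p : Pt) : ℝ := (omg' k * x1 p - omg k * x2 p) / (omg' k - omg k)

/-- The coordinate `s₂`. -/
def s2 (k : ℕ) (p : Pt) : ℝ := (x1 p - x2 p) / (omg k - omg' k)

/-- The ratio `r = y₁/y₂`. -/
def rr (p : Pt) : ℝ := y1 p / y2 p

/-- The height `h = y₁ y₂`. -/
def hh (p : Pt) : ℝ := y1 p * y2 p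

/-- `‖cZ+d‖ = ((cx₁+d)² + c²y₁²)((c'x₂+d')² + c'²y₂²)`, where `c = (c, c')`, `d = (d, d')`
are given by their two real embeddings. -/
def HNorm (c d : ℝ × ℝ) (p : Pt) : ℝ :=
  ((c.1 * x1 p + d.1) ^ 2 + c.1 ^ 2 * y1 p ^ 2) *
    ((c.2 * x2 p + d.2) ^ 2 + c.2 ^ 2 * y2 p ^ 2)

/-- `S = {(c,d) ∈ R² : cR + dR = R}`. -/
def Spairs (k : ℕ) : Set (R k × R k) := {cd | Ideal.span {cd.1, cd.2} = ⊤}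

/-- `V_{c,d}^≥ = {Z ∈ H²×H² : ‖cZ+d‖ ≥ 1}`. -/
def Vge (k : ℕ) (cd : R k × R k) : Set Pt :=
  {p ∈ HH | 1 ≤ HNorm (cd.1 : ℝ × ℝ) (cd.2 : ℝ × ℝ) p}

/-- `V_{c,d}^≤ = {Z ∈ H²×H² : ‖cZ+d‖ ≤ 1}`. -/
def Vle (k : ℕ) (cd : R k × R k) : Set Pt :=
  {p ∈ HH | HNorm (cd.1 : ℝ × ℝ) (cd.2 : ℝ × ℝ) p ≤ 1}

/-- `V_{c,d} = {Z ∈ H²×H² : ‖cZ+d‖ = 1}`. -/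
def Veq (k : ℕ) (cd : R k × R k) : Set Pt :=
  {p ∈ HH | HNorm (cd.1 : ℝ × ℝ) (cd.2 : ℝ × ℝ) p = 1}

/-- `F₀ = {Z ∈ H²×H² : ‖cZ+d‖ ≥ 1 for all (c,d) ∈ S}`. -/
def F0 (k : ℕ) : Set Pt :=
  {p ∈ HH | ∀ cd ∈ Spairs k, 1 ≤ HNorm (cd.1 : ℝ × ℝ) (cd.2 : ℝ × ℝ) p}

/-- `F_∞ = {(s₁,s₂,r,h) : |s₁| ≤ 1/2, |s₂| ≤ 1/2, ε₀⁻² ≤ r ≤ ε₀²}`, where `ε` stands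
for the fundamental unit `ε₀`. -/
def FInf (k : ℕ) (ε : ℝ) : Set Pt :=
  {p ∈ HH | |s1 k p| ≤ 1 / 2 ∧ |s2 k p| ≤ 1 / 2 ∧ (ε ^ 2)⁻¹ ≤ rr p ∧ rr p ≤ ε ^ 2}

/-- `F = F_∞ ∩ F₀`. -/
def F (k : ℕ) (ε : ℝ) : Set Pt := FInf k ε ∩ F0 k

/-- `SL₂(R)`. -/
abbrev SL (k : ℕ) := Matrix.SpecialLinearGroup (Fin 2) (R k)

/-- Möbius action on the upper half-plane: image of `x + y i` under `(a b; c d)`. -/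
def moeb (a b c d x y : ℝ) : ℝ × ℝ :=
  (((a * x + b) * (c * x + d) + a * c * y ^ 2) / ((c * x + d) ^ 2 + c ^ 2 * y ^ 2),
    y / ((c * x + d) ^ 2 + c ^ 2 * y ^ 2))

/-- The action of `γ ∈ SL₂(R)` on `H²×H²`: `γ` acts on the first factor through the first
embedding and through the conjugate matrix `γ'` (second embedding) on the second factor.
This descends to the Hilbert modular group `PSL₂(R)`. -/
def act (k : ℕ) (g : SL k) (p : Pt) : Pt :=
  ((moeb (g.1 0 0 : ℝ × ℝ).1 (g.1 0 1 : ℝ × ℝ).1 (g.1 1 0 : ℝ × ℝ).1 (g.1 1 1 : ℝ × ℝ).1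
      (x1 p) (y1 p)).1,
   (moeb (g.1 0 0 : ℝ × ℝ).2 (g.1 0 1 : ℝ × ℝ).2 (g.1 1 0 : ℝ × ℝ).2 (g.1 1 1 : ℝ × ℝ).2
      (x2 p) (y2 p)).1,
   (moeb (g.1 0 0 : ℝ × ℝ).1 (g.1 0 1 : ℝ × ℝ).1 (g.1 1 0 : ℝ × ℝ).1 (g.1 1 1 : ℝ × ℝ).1
      (x1 p) (y1 p)).2,
   (moeb (g.1 0 0 : ℝ × ℝ).2 (g.1 0 1 : ℝ × ℝ).2 (g.1 1 0 : ℝ × ℝ).2 (g.1 1 1 : ℝ × ℝ).2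
      (x2 p) (y2 p)).2)

/-- The pair of real embeddings of a unit of `R`. -/
def unitVal (k : ℕ) (u : (R k)ˣ) : ℝ × ℝ := ((u : R k) : ℝ × ℝ)

/-- `e` is the fundamental unit of `R`: the smallest unit of `R` greater than `1`
(with respect to the first embedding). -/
def IsFundUnit (k : ℕ) (e : (R k)ˣ) : Prop :=
  1 < (unitVal k e).1 ∧
    ∀ v : (R k)ˣ, 1 < (unitVal k v).1 → (unitVal k e).1 ≤ (unitVal k v).1

/-- The real number `ε₀ > 1`, the fundamental unit under the first embedding. -/
def eps (k : ℕ) (e : (R k)ˣ) : ℝ := (unitVal k e).1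


/-- The norm `N(c) = c c'` of an element of `R` (as a real number). -/
def Nm (k : ℕ) (c : R k) : ℝ := ((c : ℝ × ℝ)).1 * ((c : ℝ × ℝ)).2

/-- A subset `C` of `H²×H²` is hyperbolically bounded if it is bounded in the
Euclidean metric and `y₁, y₂ > ε` on `C` for some `ε > 0`. -/
def HypBounded (C : Set Pt) : Prop :=
  C ⊆ HH ∧ Bornology.IsBounded C ∧ ∃ ε > (0 : ℝ), ∀ p ∈ C, ε < y1 p ∧ ε < y2 p

/-- `V_{C,μ} = {(c,d) ∈ R × R : ‖cZ+d‖ ≤ μ for some Z ∈ C}`. -/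
def VCmu (k : ℕ) (C : Set Pt) (μ : ℝ) : Set (R k × R k) :=
  {cd | ∃ p ∈ C, HNorm (cd.1 : ℝ × ℝ) (cd.2 : ℝ × ℝ) p ≤ μ}

/-- The conditions (8) of Theorem `FiniteSides` on a pair `(c,d) ∈ R²`. -/
def SCond (k : ℕ) (ε : ℝ) (cd : R k × R k) : Prop :=
  cd.1 ≠ 0 ∧ Ideal.span {cd.1, cd.2} = ⊤ ∧
    |Nm k cd.1| ≤ 2 * k / (k0 k) ^ 2 ∧
    |((cd.2 : ℝ × ℝ)).1 / ((cd.1 : ℝ × ℝ)).1| <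
      ε * Real.sqrt (2 * k / (Nm k cd.1 ^ 2 * (k0 k) ^ 2) - (k0 k) ^ 2 / (2 * k)) +
        (1 + omg k) / 2 ∧
    |((cd.2 : ℝ × ℝ)).2 / ((cd.1 : ℝ × ℝ)).2| <
      ε * Real.sqrt (2 * k / (Nm k cd.1 ^ 2 * (k0 k) ^ 2) - (k0 k) ^ 2 / (2 * k)) +
        (1 - omg' k) / 2

/-- `S₁` is a set of representatives, up to multiplication by units of `R`, of the pairs
`(c,d) ∈ R²` satisfying the conditions `SCond`. -/
def IsRepSet (k : ℕ) (ε : ℝ) (S1 : Set (R k × R k)) : Prop :=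
  (∀ cd ∈ S1, SCond k ε cd) ∧
    (∀ cd : R k × R k, SCond k ε cd →
      ∃ ab ∈ S1, ∃ u : (R k)ˣ, cd.1 = (u : R k) * ab.1 ∧ cd.2 = (u : R k) * ab.2) ∧
    (∀ ab ∈ S1, ∀ ab' ∈ S1,
      (∃ u : (R k)ˣ, ab'.1 = (u : R k) * ab.1 ∧ ab'.2 = (u : R k) * ab.2) → ab = ab')

/-- The family `𝒱_∞ = {V_i^± : i = 1,2,3}`. -/
def VfamInf (k : ℕ) (ε : ℝ) : Set (Set Pt) :=
  { {p ∈ HH | s1 k p = 1 / 2}, {p ∈ HH | s1 k p = -(1 / 2)},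
    {p ∈ HH | s2 k p = 1 / 2}, {p ∈ HH | s2 k p = -(1 / 2)},
    {p ∈ HH | rr p = ε ^ 2}, {p ∈ HH | rr p = (ε ^ 2)⁻¹} }

/-- The family `𝒱 = {V_{c,d} : (c,d) ∈ S, c ≠ 0}`. -/
def Vfam (k : ℕ) : Set (Set Pt) :=
  {V | ∃ cd ∈ Spairs k, cd.1 ≠ 0 ∧ V = Veq k cd}

/-- The family `𝓜 = {γ(M) : γ ∈ Γ, M ∈ 𝒱 ∪ 𝒱_∞}`. -/
def Mfam (k : ℕ) (ε : ℝ) : Set (Set Pt) :=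
  {M | ∃ g : SL k, ∃ V ∈ Vfam k ∪ VfamInf k ε, M = act k g '' V}

/-- `ω` as an element of `R`. -/
def omR (k : ℕ) : R k := ⟨(omg k, omg' k), Subring.subset_closure rfl⟩

/-- The side-pairing transformations: `γ ≠ 1` (in `PSL₂(R)`) such that `F ∩ γ⁻¹(F)` has
Hausdorff dimension `3`. -/
def SidePairings (k : ℕ) (ε : ℝ) : Set (SL k) :=
  {g | g ≠ 1 ∧ g.1 ≠ -1 ∧ dimH (F k ε ∩ act k g⁻¹ '' F k ε) = 3}



lemma pos_sorted (a b c f g h : ℝ) (h0 : 0 ≤ h) (hg : h ≤ g) (gf : g ≤ f)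
    (hb : 2*f ≤ b) (hc : 2*f ≤ c) (ha : 2*g ≤ a) :
    0 ≤ a*b*c + 4*f*g*h - 2*a*f^2 - 2*b*g^2 - 2*c*h^2 := by
  obtain ⟨s, rfl⟩ : ∃ s, a = 2*g + s := ⟨a-2*g, by ring⟩
  obtain ⟨t, rfl⟩ : ∃ t, b = 2*f + t := ⟨b-2*f, by ring⟩
  obtain ⟨u, rfl⟩ : ∃ u, c = 2*f + u := ⟨c-2*f, by ring⟩
  obtain ⟨p, rfl⟩ : ∃ p, g = h + p := ⟨g-h, by ring⟩
  obtain ⟨q, rfl⟩ : ∃ q, f = h + p + q := ⟨f-(h+p), by ring⟩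
  have hs : 0 ≤ s := by linarith
  have ht : 0 ≤ t := by linarith
  have hu : 0 ≤ u := by linarith
  have hp : 0 ≤ p := by linarith
  have hq : 0 ≤ q := by linarith
  ring_nf
  positivity

/-- negative-case polynomial -/
def negP (a b c f g h : ℝ) : ℝ := a*b*c - 4*f*g*h - 2*a*f^2 - 2*b*g^2 - 2*c*h^2

lemma negA1 (x y p s t u : ℝ) (hx : 0 ≤ x) (hy : 0 ≤ y) (hp : 0 ≤ p) (hs : 0 ≤ s) (ht : 0 ≤ t) (hu : 0 ≤ u) :
    0 ≤ negP (2*(y+p)+(2*y+s)) (2*(y+p+(y+x))+t) (2*(y+p+(y+x))+u) (y+p+(y+x)) (y+p) y := by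
  unfold negP; ring_nf; positivity

lemma negA2 (e m p s t u : ℝ) (he : 0 ≤ e) (hm : 0 ≤ m) (hp : 0 ≤ p) (hs : 0 ≤ s) (ht : 0 ≤ t) (hu : 0 ≤ u) :
    0 ≤ negP (2*((e+m)+p)+(2*(e+m)+s)) (2*((e+m)+p+e)+(2*m+t)) (2*((e+m)+p+e)+u) ((e+m)+p+e) ((e+m)+p) (e+m) := by
  unfold negP; ring_nf; positivity

lemma negA3 (e p s t r x : ℝ) (he : 0 ≤ e) (hp : 0 ≤ p) (hs : 0 ≤ s) (ht : 0 ≤ t) (hr : 0 ≤ r) (hx : 0 ≤ x) :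
    0 ≤ negP (2*((e+(t+r)/2)+p)+(2*(e+(t+r)/2)+s)) (2*((e+(t+r)/2)+p+e)+t) (2*((e+(t+r)/2)+p+e)+(r+x)) ((e+(t+r)/2)+p+e) ((e+(t+r)/2)+p) (e+(t+r)/2) := by
  unfold negP; ring_nf; positivity

lemma negB1a (e p s x t u : ℝ) (he : 0 ≤ e) (hp : 0 ≤ p) (hs : 0 ≤ s) (hx : 0 ≤ x) (ht : 0 ≤ t) (hu : 0 ≤ u) :
    0 ≤ negP (2*(((s+s+x)/2)+p)+s) (2*(((s+s+x)/2)+p+e)+(s+x+t)) (2*(((s+s+x)/2)+p+e)+(s+x+u)) (((s+s+x)/2)+p+e) (((s+s+x)/2)+p) ((s+s+x)/2) := by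
  unfold negP; ring_nf; positivity

lemma negB1b (p r x y t u : ℝ) (hp : 0 ≤ p) (hr : 0 ≤ r) (hx : 0 ≤ x) (hy : 0 ≤ y) (ht : 0 ≤ t) (hu : 0 ≤ u) :
    0 ≤ negP (2*(((2*r+y)/2)+p)+(r+y)) (2*(((2*r+y)/2)+p+((x+y)/2))+(r+t)) (2*(((2*r+y)/2)+p+((x+y)/2))+(r+u)) (((2*r+y)/2)+p+((x+y)/2)) (((2*r+y)/2)+p) ((2*r+y)/2) := by
  unfold negP; ring_nf; positivity

lemma negB2 (e p r m t u : ℝ) (he : 0 ≤ e) (hp : 0 ≤ p) (hr : 0 ≤ r) (hm : 0 ≤ m) (ht : 0 ≤ t) (hu : 0 ≤ u) :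
    0 ≤ negP (2*(((r+2*e+m+r)/2)+p)+(r+2*e+m)) (2*(((r+2*e+m+r)/2)+p+e)+(r+m+t)) (2*(((r+2*e+m+r)/2)+p+e)+(r+u)) (((r+2*e+m+r)/2)+p+e) (((r+2*e+m+r)/2)+p) ((r+2*e+m+r)/2) := by
  unfold negP; ring_nf; positivity

lemma negB3 (e p r t y u : ℝ) (he : 0 ≤ e) (hp : 0 ≤ p) (hr : 0 ≤ r) (ht : 0 ≤ t) (hy : 0 ≤ y) (hu : 0 ≤ u) :
    0 ≤ negP (2*(((r+2*e+t+y+r)/2)+p)+(r+2*e+t+y)) (2*(((r+2*e+t+y+r)/2)+p+e)+(r+t)) (2*(((r+2*e+t+y+r)/2)+p+e)+(r+y+u)) (((r+2*e+t+y+r)/2)+p+e) (((r+2*e+t+y+r)/2)+p) ((r+2*e+t+y+r)/2) := by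
  unfold negP; ring_nf; positivity

lemma neg_sorted (a b c f g h : ℝ) (h0 : 0 ≤ h) (hg : h ≤ g) (gf : g ≤ f)
    (hb : 2*f ≤ b) (hc : 2*f ≤ c) (ha : 2*g ≤ a) (hab : 2*(f+g+h) ≤ a+b) (hac : 2*(f+g+h) ≤ a+c)
    (hbc : 2*(f+g+h) ≤ b+c) :
    0 ≤ a*b*c - 4*f*g*h - 2*a*f^2 - 2*b*g^2 - 2*c*h^2 := by
  change 0 ≤ negP a b c f g h
  by_cases hs : 2*g+2*h ≤ a
  · by_cases h1 : h ≤ f - g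
    · convert negA1 (f-g-h) h (g-h) (a-2*g-2*h) (b-2*f) (c-2*f) (by linarith) (by linarith) (by linarith) (by linarith) (by linarith) (by linarith) using 1
      congr 1 <;> ring
    · by_cases h2 : 2*(h-(f-g)) ≤ b-2*f
      · convert negA2 (f-g) (h-(f-g)) (g-h) (a-2*g-2*h) (b-2*f-2*(h-(f-g))) (c-2*f) (by linarith) (by linarith) (by linarith) (by linarith) (by linarith) (by linarith) using 1
        congr 1 <;> ring
      · convert negA3 (f-g) (g-h) (a-2*g-2*h) (b-2*f) (2*(h-(f-g))-(b-2*f)) (c-2*f-(2*(h-(f-g))-(b-2*f))) (by linarith) (by linarith) (by linarith) (by linarith) (by linarith) (by linarith) using 1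
        congr 1 <;> ring
  · obtain ⟨s, rfl⟩ : ∃ s, a = 2*g + s := ⟨a-2*g, by ring⟩
    obtain ⟨e, rfl⟩ : ∃ e, f = g + e := ⟨f-g, by ring⟩
    obtain ⟨t, rfl⟩ : ∃ t, b = 2*(g+e) + t := ⟨b-2*(g+e), by ring⟩
    obtain ⟨u, rfl⟩ : ∃ u, c = 2*(g+e) + u := ⟨c-2*(g+e), by ring⟩
    obtain ⟨r, rfl⟩ : ∃ r, h = (s + r)/2 := ⟨2*h-s, by ring⟩
    by_cases h1 : s ≤ r
    · convert negB1a e (g-(s+r)/2) s (r-s) (t-r) (u-r) (by linarith) (by linarith) (by linarith) (by linarith) (by linarith) (by linarith) using 1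
      congr 1 <;> ring
    · by_cases h2 : s - r ≤ 2*e
      · convert negB1b (g-(s+r)/2) r (2*e-(s-r)) (s-r) (t-r) (u-r) (by linarith) (by linarith) (by linarith) (by linarith) (by linarith) (by linarith) using 1
        congr 1 <;> ring
      · by_cases h3 : s-r-2*e ≤ t - r
        · convert negB2 e (g-(s+r)/2) r (s-r-2*e) (t-r-(s-r-2*e)) (u-r) (by linarith) (by linarith) (by linarith) (by linarith) (by linarith) (by linarith) using 1
          congr 1 <;> ring
        · convert negB3 e (g-(s+r)/2) r (t-r) (s-r-2*e-(t-r)) (u-r-(s-r-2*e-(t-r))) (by linarith) (by linarith) (by linarith) (by linarith) (by linarith) (by linarith) using 1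
          congr 1 <;> ring

lemma pos_eq (f g h : ℝ) (h0 : 0 ≤ h) (hg : h ≤ g) (gf : g ≤ f) (f1 : f ≤ 1)
    (e : f^2+g^2+h^2 = 2 + f*g*h) : f = 1 ∧ g = 1 := by
  have h1 : h^2 ≤ g*h := by nlinarith
  have h2 : g*h*(1-f) ≤ g*g*(1-f) := by
    apply mul_le_mul_of_nonneg_right _ (by linarith); nlinarith
  have h3 : 2 ≤ f^2 + g^2*(2-f) := by nlinarith
  have h4 : g^2 * (2-f) ≤ 1*(2-f) := by
    apply mul_le_mul_of_nonneg_right _ (by linarith); nlinarith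
  have hf0 : 0 < f := by nlinarith
  have : f = 1 := by
    by_contra hne
    have : f < 1 := lt_of_le_of_ne f1 hne
    nlinarith
  subst this
  exact ⟨rfl, by nlinarith⟩

lemma neg_eq' (f g h : ℝ) (h0 : 0 ≤ h) (hg : h ≤ g) (gf : g ≤ f) (f1 : f ≤ 1)
    (hs : f + g + h ≤ 2)
    (e : f^2+g^2+h^2 + f*g*h = 2) : f = 1 ∧ g = 1 := by
  have hfg : 1 < f + g := by
    by_contra hc
    have h1 : h^2 ≤ g^2 := by nlinarith
    have h2 : f*g*h ≤ 1*g*g := by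
      have : f*g ≤ 1 * g := by nlinarith
      nlinarith
    have h3 : g ≤ 1/2 := by linarith
    nlinarith
  have hm : f^2+g^2+(2-f-g)^2 + f*g*(2-f-g) ≥ 2 := by
    have h1 : h^2 ≤ (2-f-g)^2 := by nlinarith
    have h2 : f*g*h ≤ f*g*(2-f-g) := by
      apply mul_le_mul_of_nonneg_left (by linarith); nlinarith
    linarith
  have key : f^2+g^2+(2-f-g)^2 + f*g*(2-f-g) - 2 = -((2-f-g)*(f+g-1)) - (1-f)*(1-g)*(f+g) := by ring
  have h5 : 0 ≤ (1-f)*(1-g)*(f+g) := by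
    apply mul_nonneg (mul_nonneg _ _) <;> linarith
  have h6 : (2-f-g)*(f+g-1) ≤ 0 := by linarith
  have : 2 - f - g ≤ 0 := by
    by_contra hc
    push Not at hc
    nlinarith
  constructor <;> linarith

/-- combined statement, nonneg off-diagonal. -/
def Good (a b c D f g h : ℝ) : Prop :=
  a*b*c ≤ 2*D ∧ (a = 2 → b = 2 → c = 2 → D = 4 → (f = 1 ∧ g = 1) ∨ (f = 1 ∧ h = 1) ∨ (g = 1 ∧ h = 1))

lemma pos_all (a b c f g h : ℝ) (f0 : 0 ≤ f) (g0 : 0 ≤ g) (h0 : 0 ≤ h)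
    (hfb : 2*f ≤ b) (hfc : 2*f ≤ c) (hga : 2*g ≤ a) (hgc : 2*g ≤ c) (hha : 2*h ≤ a) (hhb : 2*h ≤ b) :
    Good a b c (a*b*c + 2*f*g*h - a*f^2 - b*g^2 - c*h^2) f g h := by
  constructor
  · rcases le_total f g with h1 | h1 <;> rcases le_total g h with h2 | h2 <;>
      rcases le_total f h with h3 | h3
    · have := pos_sorted c b a h g f f0 (by linarith) (by linarith) (by linarith) (by linarith) (by linarith); linarith
    · have := pos_sorted c b a h g f f0 (by linarith) (by linarith) (by linarith) (by linarith) (by linarith); linarith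
    · have := pos_sorted b c a g h f f0 (by linarith) (by linarith) (by linarith) (by linarith) (by linarith); linarith
    · have := pos_sorted b a c g f h h0 (by linarith) (by linarith) (by linarith) (by linarith) (by linarith); linarith
    · have := pos_sorted c a b h f g g0 (by linarith) (by linarith) (by linarith) (by linarith) (by linarith); linarith
    · have := pos_sorted a c b f h g g0 (by linarith) (by linarith) (by linarith) (by linarith) (by linarith); linarith
    · have := pos_sorted a b c f g h h0 (by linarith) (by linarith) (by linarith) (by linarith) (by linarith); linarith
    · have := pos_sorted a b c f g h h0 (by linarith) (by linarith) (by linarith) (by linarith) (by linarith); linarith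
  · rintro rfl rfl rfl hD
    rcases le_total f g with h1 | h1 <;> rcases le_total g h with h2 | h2 <;>
      rcases le_total f h with h3 | h3
    · have := pos_eq h g f f0 (by linarith) (by linarith) (by linarith) (by linarith); tauto
    · have := pos_eq h g f f0 (by linarith) (by linarith) (by linarith) (by linarith); tauto
    · have := pos_eq g h f f0 (by linarith) (by linarith) (by linarith) (by linarith); tauto
    · have := pos_eq g f h h0 (by linarith) (by linarith) (by linarith) (by linarith); tauto
    · have := pos_eq h f g g0 (by linarith) (by linarith) (by linarith) (by linarith); tauto
    · have := pos_eq f h g g0 (by linarith) (by linarith) (by linarith) (by linarith); tauto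
    · have := pos_eq f g h h0 (by linarith) (by linarith) (by linarith) (by linarith); tauto
    · have := pos_eq f g h h0 (by linarith) (by linarith) (by linarith) (by linarith); tauto

lemma neg_all (a b c f g h : ℝ) (f0 : 0 ≤ f) (g0 : 0 ≤ g) (h0 : 0 ≤ h)
    (hfb : 2*f ≤ b) (hfc : 2*f ≤ c) (hga : 2*g ≤ a) (hgc : 2*g ≤ c) (hha : 2*h ≤ a) (hhb : 2*h ≤ b)
    (hab : 2*(f+g+h) ≤ a+b) (hac : 2*(f+g+h) ≤ a+c) (hbc : 2*(f+g+h) ≤ b+c) :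
    Good a b c (a*b*c - 2*f*g*h - a*f^2 - b*g^2 - c*h^2) f g h := by
  constructor
  · rcases le_total f g with h1 | h1 <;> rcases le_total g h with h2 | h2 <;>
      rcases le_total f h with h3 | h3
    · have := neg_sorted c b a h g f f0 (by linarith) (by linarith) (by linarith) (by linarith) (by linarith) (by linarith) (by linarith) (by linarith); linarith
    · have := neg_sorted c b a h g f f0 (by linarith) (by linarith) (by linarith) (by linarith) (by linarith) (by linarith) (by linarith) (by linarith); linarith
    · have := neg_sorted b c a g h f f0 (by linarith) (by linarith) (by linarith) (by linarith) (by linarith) (by linarith) (by linarith) (by linarith); linarith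
    · have := neg_sorted b a c g f h h0 (by linarith) (by linarith) (by linarith) (by linarith) (by linarith) (by linarith) (by linarith) (by linarith); linarith
    · have := neg_sorted c a b h f g g0 (by linarith) (by linarith) (by linarith) (by linarith) (by linarith) (by linarith) (by linarith) (by linarith); linarith
    · have := neg_sorted a c b f h g g0 (by linarith) (by linarith) (by linarith) (by linarith) (by linarith) (by linarith) (by linarith) (by linarith); linarith
    · have := neg_sorted a b c f g h h0 (by linarith) (by linarith) (by linarith) (by linarith) (by linarith) (by linarith) (by linarith) (by linarith); linarith
    · have := neg_sorted a b c f g h h0 (by linarith) (by linarith) (by linarith) (by linarith) (by linarith) (by linarith) (by linarith) (by linarith); linarith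
  · rintro rfl rfl rfl hD
    rcases le_total f g with h1 | h1 <;> rcases le_total g h with h2 | h2 <;>
      rcases le_total f h with h3 | h3
    · have := neg_eq' h g f f0 (by linarith) (by linarith) (by linarith) (by linarith) (by linarith); tauto
    · have := neg_eq' h g f f0 (by linarith) (by linarith) (by linarith) (by linarith) (by linarith); tauto
    · have := neg_eq' g h f f0 (by linarith) (by linarith) (by linarith) (by linarith) (by linarith); tauto
    · have := neg_eq' g f h h0 (by linarith) (by linarith) (by linarith) (by linarith) (by linarith); tauto
    · have := neg_eq' h f g g0 (by linarith) (by linarith) (by linarith) (by linarith) (by linarith); tauto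
    · have := neg_eq' f h g g0 (by linarith) (by linarith) (by linarith) (by linarith) (by linarith); tauto
    · have := neg_eq' f g h h0 (by linarith) (by linarith) (by linarith) (by linarith) (by linarith); tauto
    · have := neg_eq' f g h h0 (by linarith) (by linarith) (by linarith) (by linarith) (by linarith); tauto

lemma signed_all (a b c f g h : ℝ)
    (hfb : 2*|f| ≤ b) (hfc : 2*|f| ≤ c) (hga : 2*|g| ≤ a) (hgc : 2*|g| ≤ c)
    (hha : 2*|h| ≤ a) (hhb : 2*|h| ≤ b)
    (hs : ∀ m, (m = a + b ∨ m = a + c ∨ m = b + c) →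
      0 ≤ m + 2*(f+g+h) ∧ 0 ≤ m + 2*(f-g-h) ∧ 0 ≤ m + 2*(-f+g-h) ∧ 0 ≤ m + 2*(-f-g+h)) :
    Good a b c (a*b*c + 2*f*g*h - a*f^2 - b*g^2 - c*h^2) |f| |g| |h| := by
  by_cases hp : 0 ≤ f*g*h
  · have := pos_all a b c |f| |g| |h| (abs_nonneg _) (abs_nonneg _) (abs_nonneg _) hfb hfc hga hgc hha hhb
    have e : |f| * |g| * |h| = f*g*h := by rw [← abs_mul, ← abs_mul, abs_of_nonneg hp]
    simp only [sq_abs] at this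
    convert this using 1
    linear_combination -2*e
  · push Not at hp
    have e : |f| * |g| * |h| = -(f*g*h) := by rw [← abs_mul, ← abs_mul, abs_of_neg hp]
    have key : ∀ m, (m = a + b ∨ m = a + c ∨ m = b + c) → 2*(|f|+|g|+|h|) ≤ m := by
      intro m hm
      obtain ⟨h1,h2,h3,h4⟩ := hs m hm
      rcases abs_cases f with ⟨ef, hf⟩ | ⟨ef, hf⟩ <;> rcases abs_cases g with ⟨eg, hg⟩ | ⟨eg, hg⟩ <;>
       rcases abs_cases h with ⟨eh, hh⟩ | ⟨eh, hh⟩ <;> rw [ef, eg, eh] at e ⊢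
      all_goals first
        | linarith
    have := neg_all a b c |f| |g| |h| (abs_nonneg _) (abs_nonneg _) (abs_nonneg _) hfb hfc hga hgc hha hhb
      (key _ (by tauto)) (key _ (by tauto)) (key _ (by tauto))
    simp only [sq_abs] at this
    convert this using 1
    linear_combination 2*e

/-- ternary form -/
def qf (a b c f g h : ℝ) (x y z : ℤ) : ℝ :=
  a*x^2 + b*y^2 + c*z^2 + 2*f*y*z + 2*g*x*z + 2*h*x*y

lemma no_eq (a b c f g h a' b' c' f' g' h' : ℝ)
    (hA : a*b*c + 2*f*g*h - a*f^2 - b*g^2 - c*h^2 = 0)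
    (H : ∀ x y z : ℤ, qf (a+a') (b+b') (c+c') (f+f') (g+g') (h+h') x y z = 2 → (x ≠ 0 ∨ y ≠ 0 ∨ z ≠ 0) →
      qf a b c f g h x y z = 1)
    (ea : a + a' = 2) (eb : b + b' = 2) (ec : c + c' = 2)
    (ef : |f + f'| = 1) (eg : |g + g'| = 1)
    (eh : h + h' = 0 ∨ h + h' = (f+f')*(g+g')) : False := by
  rw [ea, eb, ec] at H
  have h1 := H 1 0 0 (by simp [qf]) (by simp)
  have h2 := H 0 1 0 (by simp [qf]) (by simp)
  have h3 := H 0 0 1 (by simp [qf]) (by simp)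
  simp [qf] at h1 h2 h3
  subst h1 h2 h3
  rcases eq_or_eq_neg_of_abs_eq ef with ef | ef <;> rcases eq_or_eq_neg_of_abs_eq eg with eg | eg <;>
    rw [ef, eg] at eh H
  · have h4 := H 1 0 (-1) (by norm_num [qf]) (by simp)
    have h5 := H 0 1 (-1) (by norm_num [qf]) (by simp)
    obtain rfl : g = 1/2 := by simp [qf] at h4; linarith
    obtain rfl : f = 1/2 := by simp [qf] at h5; linarith
    rcases eh with eh | eh <;> rw [eh] at H
    · have h6 := H 1 1 (-1) (by norm_num [qf]) (by simp)
      obtain rfl : h = 0 := by simp [qf] at h6; linarith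
      norm_num at hA
    · have h6 := H 1 (-1) 0 (by norm_num [qf]) (by simp)
      obtain rfl : h = 1/2 := by simp [qf] at h6; linarith
      norm_num at hA
  · have h4 := H 1 0 1 (by norm_num [qf]) (by simp)
    have h5 := H 0 1 (-1) (by norm_num [qf]) (by simp)
    obtain rfl : g = -1/2 := by simp [qf] at h4; linarith
    obtain rfl : f = 1/2 := by simp [qf] at h5; linarith
    rcases eh with eh | eh <;> rw [eh] at H
    · have h6 := H (-1) 1 (-1) (by norm_num [qf]) (by simp)
      obtain rfl : h = 0 := by simp [qf] at h6; linarith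
      norm_num at hA
    · have h6 := H 1 1 0 (by norm_num [qf]) (by simp)
      obtain rfl : h = -1/2 := by simp [qf] at h6; linarith
      norm_num at hA
  · have h4 := H 1 0 (-1) (by norm_num [qf]) (by simp)
    have h5 := H 0 1 1 (by norm_num [qf]) (by simp)
    obtain rfl : g = 1/2 := by simp [qf] at h4; linarith
    obtain rfl : f = -1/2 := by simp [qf] at h5; linarith
    rcases eh with eh | eh <;> rw [eh] at H
    · have h6 := H 1 (-1) (-1) (by norm_num [qf]) (by simp)
      obtain rfl : h = 0 := by simp [qf] at h6; linarith
      norm_num at hA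
    · have h6 := H 1 1 0 (by norm_num [qf]) (by simp)
      obtain rfl : h = -1/2 := by simp [qf] at h6; linarith
      norm_num at hA
  · have h4 := H 1 0 1 (by norm_num [qf]) (by simp)
    have h5 := H 0 1 1 (by norm_num [qf]) (by simp)
    obtain rfl : g = -1/2 := by simp [qf] at h4; linarith
    obtain rfl : f = -1/2 := by simp [qf] at h5; linarith
    rcases eh with eh | eh <;> rw [eh] at H
    · have h6 := H 1 1 1 (by norm_num [qf]) (by simp)
      obtain rfl : h = 0 := by simp [qf] at h6; linarith
      norm_num at hA
    · have h6 := H 1 (-1) 0 (by norm_num [qf]) (by simp)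
      obtain rfl : h = 1/2 := by simp [qf] at h6; linarith
      norm_num at hA

lemma h_cases (f g h : ℝ) (hf : |f| = 1) (hg : |g| = 1)
    (e : 2*2*2 + 2*f*g*h - 2*f^2 - 2*g^2 - 2*h^2 = (4:ℝ)) : h = 0 ∨ h = f * g := by
  have h1 : f^2 = 1 := by rw [← sq_abs, hf]; norm_num
  have h2 : g^2 = 1 := by rw [← sq_abs, hg]; norm_num
  rw [h1, h2] at e
  have : h * (h - f*g) = 0 := by linarith
  rcases mul_eq_zero.1 this with h | h
  · exact Or.inl h
  · right; linarith

lemma finish (a b c f g h a' b' c' f' g' h' : ℝ)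
    (hA : a*b*c + 2*f*g*h - a*f^2 - b*g^2 - c*h^2 = 0)
    (H : ∀ x y z : ℤ, (x ≠ 0 ∨ y ≠ 0 ∨ z ≠ 0) →
      0 ≤ qf a b c f g h x y z ∧ 0 ≤ qf a' b' c' f' g' h' x y z ∧
        1 ≤ qf a b c f g h x y z * qf a' b' c' f' g' h' x y z)
    (hfb : 2*|f+f'| ≤ b+b') (hfc : 2*|f+f'| ≤ c+c') (hga : 2*|g+g'| ≤ a+a') (hgc : 2*|g+g'| ≤ c+c')
    (hha : 2*|h+h'| ≤ a+a') (hhb : 2*|h+h'| ≤ b+b')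
    (hs : ∀ m, (m = (a+a') + (b+b') ∨ m = (a+a') + (c+c') ∨ m = (b+b') + (c+c')) →
      0 ≤ m + 2*((f+f')+(g+g')+(h+h')) ∧ 0 ≤ m + 2*((f+f')-(g+g')-(h+h')) ∧
      0 ≤ m + 2*(-(f+f')+(g+g')-(h+h')) ∧ 0 ≤ m + 2*(-(f+f')-(g+g')+(h+h'))) :
    4 < (a+a')*(b+b')*(c+c') + 2*(f+f')*(g+g')*(h+h') - (a+a')*(f+f')^2 - (b+b')*(g+g')^2
      - (c+c')*(h+h')^2 := by
  have hadd : ∀ x y z : ℤ, qf (a+a') (b+b') (c+c') (f+f') (g+g') (h+h') x y z =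
      qf a b c f g h x y z + qf a' b' c' f' g' h' x y z := by
    intro x y z; unfold qf; ring
  have H2 : ∀ x y z : ℤ, (x ≠ 0 ∨ y ≠ 0 ∨ z ≠ 0) →
      2 ≤ qf (a+a') (b+b') (c+c') (f+f') (g+g') (h+h') x y z := by
    intro x y z hx
    obtain ⟨p1, p2, p3⟩ := H x y z hx
    rw [hadd]
    nlinarith [sq_nonneg (qf a b c f g h x y z - qf a' b' c' f' g' h' x y z)]
  have H1 : ∀ x y z : ℤ, qf (a+a') (b+b') (c+c') (f+f') (g+g') (h+h') x y z = 2 →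
      (x ≠ 0 ∨ y ≠ 0 ∨ z ≠ 0) → qf a b c f g h x y z = 1 := by
    intro x y z e hx
    obtain ⟨p1, p2, p3⟩ := H x y z hx
    rw [hadd] at e
    have e2 : qf a' b' c' f' g' h' x y z = 2 - qf a b c f g h x y z := by linarith
    rw [e2] at p3
    nlinarith [sq_nonneg (qf a b c f g h x y z - 1)]
  have ha := H2 1 0 0 (by simp)
  have hb := H2 0 1 0 (by simp)
  have hc := H2 0 0 1 (by simp)
  simp [qf] at ha hb hc
  obtain ⟨g1, g2⟩ := signed_all _ _ _ _ _ _ hfb hfc hga hgc hha hhb hs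
  by_contra hcon
  push Not at hcon
  have hab : 4 ≤ (a+a')*(b+b') := by nlinarith
  have e8 : (a+a')*(b+b')*(c+c') ≤ 8 := by linarith
  have hc2 : c + c' = 2 := by nlinarith
  rw [hc2] at e8
  have ha2 : a + a' = 2 := by nlinarith
  have hb2 : b + b' = 2 := by nlinarith
  rw [ha2, hb2, hc2] at g1 hcon
  rw [ha2, hb2, hc2] at g2
  have hD : 2*2*2 + 2*(f+f')*(g+g')*(h+h') - 2*(f+f')^2 - 2*(g+g')^2 - 2*(h+h')^2 = (4:ℝ) := by linarith
  rcases g2 rfl rfl rfl hD with ⟨e1, e2⟩ | ⟨e1, e2⟩ | ⟨e1, e2⟩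
  · exact no_eq a b c f g h a' b' c' f' g' h' hA H1 ha2 hb2 hc2 e1 e2
      (h_cases _ _ _ e1 e2 hD)
  · refine no_eq a c b f h g a' c' b' f' h' g' (by linarith) ?_ ha2 hc2 hb2 e1 e2
      (h_cases _ _ _ e1 e2 (by linarith))
    intro x y z e hx
    rw [← H1 x z y (by rw [← e]; unfold qf; ring) (by tauto)]
    unfold qf; ring
  · refine no_eq c b a h g f c' b' a' h' g' f' (by linarith) ?_ hc2 hb2 ha2 e2 e1
      (h_cases _ _ _ e2 e1 (by linarith))
    intro x y z e hx
    rw [← H1 z y x (by rw [← e]; unfold qf; ring) (by tauto)]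
    unfold qf; ring

open Matrix

/-- real Gram matrix after integral base change. -/
noncomputable def gr (A : Matrix (Fin 3) (Fin 3) ℝ) (W : Matrix (Fin 3) (Fin 3) ℤ) : Matrix (Fin 3) (Fin 3) ℝ :=
  W.map (Int.cast : ℤ → ℝ) * A * (W.map (Int.cast : ℤ → ℝ))ᵀ

noncomputable def qm (A : Matrix (Fin 3) (Fin 3) ℝ) (w : Fin 3 → ℤ) : ℝ :=
  (fun i => (w i : ℝ)) ⬝ᵥ A *ᵥ (fun i => (w i : ℝ))

lemma gr_det (A) (W : Matrix (Fin 3) (Fin 3) ℤ) (hW : W.det = 1) : (gr A W).det = A.det := by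
  have : (W.map (Int.cast : ℤ → ℝ)).det = 1 := by
    have := (Int.castRingHom ℝ).map_det W
    rw [hW] at this
    simpa using this.symm
  simp [gr, this]

lemma gr_mul (A) (U W : Matrix (Fin 3) (Fin 3) ℤ) : gr A (U * W) = gr (gr A W) U := by
  have : (U * W).map (Int.cast : ℤ → ℝ) = U.map Int.cast * W.map Int.cast :=
    Matrix.map_mul (f := Int.castRingHom ℝ)
  simp only [gr, this, Matrix.transpose_mul, Matrix.mul_assoc]

lemma gr_symm (A : Matrix (Fin 3) (Fin 3) ℝ) (W) (hA : Aᵀ = A) : (gr A W)ᵀ = gr A W := by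
  simp [gr, Matrix.transpose_mul, hA, Matrix.mul_assoc]

lemma gr_add (A B : Matrix (Fin 3) (Fin 3) ℝ) (W) : gr (A + B) W = gr A W + gr B W := by
  simp [gr, Matrix.mul_add, Matrix.add_mul]

lemma gr_diag (A : Matrix (Fin 3) (Fin 3) ℝ) (W) (i) : gr A W i i = qm A (W i) := by
  simp [gr, qm, Matrix.mul_apply, dotProduct, Matrix.mulVec, Fin.sum_univ_three]
  ring

lemma qm_gr (A : Matrix (Fin 3) (Fin 3) ℝ) (W) (w : Fin 3 → ℤ) : qm (gr A W) w = qm A (w ᵥ* W) := by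
  simp [gr, qm, Matrix.mul_apply, dotProduct, Matrix.mulVec, Matrix.vecMul, Fin.sum_univ_three]
  ring

lemma qm_eq (A : Matrix (Fin 3) (Fin 3) ℝ) (hA : Aᵀ = A) (x y z : ℤ) :
    qm A ![x,y,z] = qf (A 0 0) (A 1 1) (A 2 2) (A 1 2) (A 0 2) (A 0 1) x y z := by
  have h1 : A 1 0 = A 0 1 := congrFun (congrFun hA 0) 1
  have h2 : A 2 0 = A 0 2 := congrFun (congrFun hA 0) 2
  have h3 : A 2 1 = A 1 2 := congrFun (congrFun hA 1) 2
  simp [qm, qf, dotProduct, Matrix.mulVec, Fin.sum_univ_three, h1, h2, h3]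
  ring

lemma det_sym (A : Matrix (Fin 3) (Fin 3) ℝ) (hA : Aᵀ = A) :
   A.det = A 0 0 * A 1 1 * A 2 2 + 2 * A 1 2 * A 0 2 * A 0 1 - A 0 0 * (A 1 2)^2
     - A 1 1 * (A 0 2)^2 - A 2 2 * (A 0 1)^2 := by
  have h1 : A 1 0 = A 0 1 := congrFun (congrFun hA 0) 1
  have h2 : A 2 0 = A 0 2 := congrFun (congrFun hA 0) 2
  have h3 : A 2 1 = A 1 2 := congrFun (congrFun hA 1) 2
  rw [Matrix.det_fin_three, h1, h2, h3]
  ring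

lemma exists_min (Q : Matrix (Fin 3) (Fin 3) ℝ) (hpos : ∀ w, 0 ≤ qm Q w)
    (hfin : ∀ C : ℝ, ∃ N : ℤ, ∀ w, qm Q w ≤ C → ∀ i, |w i| ≤ N) :
    ∃ W : Matrix (Fin 3) (Fin 3) ℤ, W.det = 1 ∧ ∀ V : Matrix (Fin 3) (Fin 3) ℤ, V.det = 1 →
      (gr Q W).trace ≤ (gr Q V).trace := by
  obtain ⟨N, hN⟩ := hfin (gr Q 1).trace
  let S : Set (Matrix (Fin 3) (Fin 3) ℤ) := {V | V.det = 1 ∧ (gr Q V).trace ≤ (gr Q 1).trace}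
  have hS : S.Finite := by
    have : (Set.Icc (fun _ _ => -N : Fin 3 → Fin 3 → ℤ) (fun _ _ => N)).Finite := Set.finite_Icc _ _
    refine this.subset ?_
    rintro V ⟨-, hV⟩
    have hb : ∀ i j, |V i j| ≤ N := by
      intro i
      refine hN (V i) ?_
      refine le_trans ?_ hV
      refine le_trans (le_of_eq (gr_diag Q V i).symm) ?_
      refine Finset.single_le_sum (f := fun i => gr Q V i i) ?_ (Finset.mem_univ i)
      intro j _
      exact (hpos _).trans_eq (gr_diag Q V j).symm
    constructor
    · intro i j; exact (abs_le.1 (hb i j)).1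
    · intro i j; exact (abs_le.1 (hb i j)).2
  obtain ⟨W, hW, hmin⟩ := hS.exists_minimalFor (fun V => (gr Q V).trace) S ⟨1, by simp [S]⟩
  refine ⟨W, hW.1, fun V hV => ?_⟩
  by_contra hc
  push Not at hc
  exact absurd (hmin (j := V) ⟨hV, le_trans hc.le hW.2⟩ hc.le) (not_le.2 hc)

lemma tern (A B : Matrix (Fin 3) (Fin 3) ℝ) (hA : Aᵀ = A) (hB : Bᵀ = B) (hdet : A.det = 0)
    (H : ∀ w : Fin 3 → ℤ, w ≠ 0 → 0 ≤ qm A w ∧ 0 ≤ qm B w ∧ 1 ≤ qm A w * qm B w)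
    (hfin : ∀ C : ℝ, ∃ N : ℤ, ∀ w, qm (A + B) w ≤ C → ∀ i, |w i| ≤ N) :
    4 < (A + B).det := by
  have hadd : ∀ w, qm (A + B) w = qm A w + qm B w := by
    intro w; simp [qm, Matrix.add_mulVec]
  obtain ⟨W, hW, hmin⟩ := exists_min (A + B) (by
    intro w
    by_cases hw : w = 0
    · subst hw; simp [qm, dotProduct]
    · have := H w hw; rw [hadd]; linarith) hfin
  have hmin' : ∀ U : Matrix (Fin 3) (Fin 3) ℤ, U.det = 1 →
      (gr A W + gr B W).trace ≤ (gr (gr A W + gr B W) U).trace := by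
    intro U hU
    have := hmin (U * W) (by rw [Matrix.det_mul, hU, hW, one_mul])
    rwa [gr_mul, gr_add] at this
  have H' : ∀ w : Fin 3 → ℤ, w ≠ 0 → 0 ≤ qm (gr A W) w ∧ 0 ≤ qm (gr B W) w ∧
      1 ≤ qm (gr A W) w * qm (gr B W) w := by
    intro w hw
    rw [qm_gr, qm_gr]
    refine H _ ?_
    intro h0
    exact hw (Matrix.eq_zero_of_vecMul_eq_zero (by rw [hW]; exact one_ne_zero) h0)
  rw [← gr_det (A + B) W hW, gr_add]
  rw [← gr_det A W hW] at hdet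
  have sA := gr_symm A W hA
  have sB := gr_symm B W hB
  generalize gr A W = A at *
  generalize gr B W = B at *
  have sAB : (A + B)ᵀ = A + B := by rw [Matrix.transpose_add, sA, sB]
  rw [det_sym _ sAB]
  rw [det_sym _ sA] at hdet
  have tr : ∀ U : Matrix (Fin 3) (Fin 3) ℤ, (gr (A+B) U).trace =
      qm (A+B) ![U 0 0, U 0 1, U 0 2] + qm (A+B) ![U 1 0, U 1 1, U 1 2] + qm (A+B) ![U 2 0, U 2 1, U 2 2] := by
    intro U
    have e : ∀ i, ![U i 0, U i 1, U i 2] = U i := by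
      intro i; ext j; fin_cases j <;> rfl
    simp only [e, Matrix.trace, Fin.sum_univ_three, Matrix.diag, gr_diag]
  simp only [tr, qm_eq _ sAB] at hmin'
  have T : (A+B).trace = (A 0 0 + B 0 0) + (A 1 1 + B 1 1) + (A 2 2 + B 2 2) := by
    simp [Matrix.trace, Fin.sum_univ_three]
  rw [T] at hmin'
  have key1 : ∀ s t : ℤ, _ := fun s t => hmin' !![1,s,t;0,1,0;0,0,1] (by simp [Matrix.det_fin_three])
  have key2 : ∀ s t : ℤ, _ := fun s t => hmin' !![1,0,0;s,1,t;0,0,1] (by simp [Matrix.det_fin_three])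
  have key3 : ∀ s t : ℤ, _ := fun s t => hmin' !![1,0,0;0,1,0;s,t,1] (by simp [Matrix.det_fin_three])
  simp [qf] at key1 key2 key3
  simp only [Matrix.add_apply]
  apply finish _ _ _ _ _ _ _ _ _ _ _ _ hdet
  · intro x y z hx
    have := H' ![x,y,z] (by
      intro h0
      have e0 := congrFun h0 0
      have e1 := congrFun h0 1
      have e2 := congrFun h0 2
      simp at e0 e1 e2
      tauto)
    rwa [qm_eq _ sA, qm_eq _ sB] at this
  all_goals clear H H' hmin' hmin tr hadd hfin
  · have h1 := key3 0 1
    have h2 := key3 0 (-1)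
    norm_num at h1 h2
    have : |A 1 2 + B 1 2| ≤ (A 1 1 + B 1 1)/2 := abs_le.2 ⟨by linarith, by linarith⟩
    linarith
  · have h1 := key2 0 1
    have h2 := key2 0 (-1)
    norm_num at h1 h2
    have : |A 1 2 + B 1 2| ≤ (A 2 2 + B 2 2)/2 := abs_le.2 ⟨by linarith, by linarith⟩
    linarith
  · have h1 := key3 1 0
    have h2 := key3 (-1) 0
    norm_num at h1 h2
    have : |A 0 2 + B 0 2| ≤ (A 0 0 + B 0 0)/2 := abs_le.2 ⟨by linarith, by linarith⟩
    linarith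
  · have h1 := key1 0 1
    have h2 := key1 0 (-1)
    norm_num at h1 h2
    have : |A 0 2 + B 0 2| ≤ (A 2 2 + B 2 2)/2 := abs_le.2 ⟨by linarith, by linarith⟩
    linarith
  · have h1 := key2 1 0
    have h2 := key2 (-1) 0
    norm_num at h1 h2
    have : |A 0 1 + B 0 1| ≤ (A 0 0 + B 0 0)/2 := abs_le.2 ⟨by linarith, by linarith⟩
    linarith
  · have h1 := key1 1 0
    have h2 := key1 (-1) 0
    norm_num at h1 h2
    have : |A 0 1 + B 0 1| ≤ (A 1 1 + B 1 1)/2 := abs_le.2 ⟨by linarith, by linarith⟩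
    linarith
  · have a1 := key1 1 1
    have a2 := key1 1 (-1)
    have a3 := key1 (-1) 1
    have a4 := key1 (-1) (-1)
    have b1 := key2 1 1
    have b2 := key2 1 (-1)
    have b3 := key2 (-1) 1
    have b4 := key2 (-1) (-1)
    have c1 := key3 1 1
    have c2 := key3 1 (-1)
    have c3 := key3 (-1) 1
    have c4 := key3 (-1) (-1)
    norm_num at a1 a2 a3 a4 b1 b2 b3 b4 c1 c2 c3 c4
    rintro m (rfl | rfl | rfl) <;> refine ⟨?_, ?_, ?_, ?_⟩ <;> linarith

lemma k0_pos (k : ℕ) : 0 < k0 k := by unfold k0; split_ifs <;> norm_num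

lemma omg_sub (k : ℕ) : omg k - omg' k = 2 * Real.sqrt k / k0 k := by
  unfold omg omg'; ring

lemma omg_quad (k : ℕ) : ∃ t n : ℤ, (omg k)^2 = t * omg k + n ∧ (omg' k)^2 = t * omg' k + n ∧
    omg k + omg' k = t ∧ omg k * omg' k = -n := by
  have hs : Real.sqrt k ^ 2 = k := Real.sq_sqrt (Nat.cast_nonneg k)
  unfold omg omg' k0
  split_ifs with h
  · obtain ⟨m, hm⟩ : ∃ m : ℕ, k = 4 * m + 1 := ⟨k / 4, by omega⟩
    have hm' : (k : ℝ) = 4 * m + 1 := by exact_mod_cast hm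
    rw [hm'] at hs ⊢
    refine ⟨1, m, ?_, ?_, ?_, ?_⟩ <;> push_cast
    · linear_combination hs / 4
    · linear_combination hs / 4
    · ring
    · linear_combination -hs / 4
  · refine ⟨2, (k:ℤ) - 1, ?_, ?_, ?_, ?_⟩ <;> push_cast
    · linear_combination hs
    · linear_combination hs
    · ring
    · linear_combination -hs

lemma mem_R_iff (k : ℕ) (x : ℝ × ℝ) :
    x ∈ R k ↔ ∃ a b : ℤ, x = ((a : ℝ) + b * omg k, (a : ℝ) + b * omg' k) := by
  constructor
  · intro hx
    obtain ⟨t, n, h1, h2, -, -⟩ := omg_quad k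
    induction hx using Subring.closure_induction with
    | mem x hx =>
      rw [Set.mem_singleton_iff] at hx
      exact ⟨0, 1, by simp [hx]⟩
    | zero => exact ⟨0, 0, by simp; rfl⟩
    | one => exact ⟨1, 0, by simp; rfl⟩
    | add x y _ _ hx hy =>
      obtain ⟨a, b, rfl⟩ := hx
      obtain ⟨c, d, rfl⟩ := hy
      refine ⟨a + c, b + d, ?_⟩
      ext <;> simp <;> ring
    | neg x _ hx =>
      obtain ⟨a, b, rfl⟩ := hx
      refine ⟨-a, -b, ?_⟩
      ext <;> simp <;> ring
    | mul x y _ _ hx hy =>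
      obtain ⟨a, b, rfl⟩ := hx
      obtain ⟨c, d, rfl⟩ := hy
      refine ⟨a * c + b * d * n, a * d + b * c + b * d * t, ?_⟩
      ext
      · simp; linear_combination (b*d : ℝ) * h1
      · simp; linear_combination (b*d : ℝ) * h2
  · rintro ⟨a, b, rfl⟩
    have h1 : (omg k, omg' k) ∈ R k := Subring.subset_closure rfl
    have := (R k).add_mem (intCast_mem (R k) a) ((R k).mul_mem (intCast_mem (R k) b) h1)
    exact this

lemma sqrt_irr (k : ℕ) (hk : Squarefree k) (hk1 : 1 < k) : Irrational (Real.sqrt k) := by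
  rw [irrational_sqrt_natCast_iff]
  rintro ⟨m, rfl⟩
  have := hk m dvd_rfl
  rw [Nat.isUnit_iff] at this
  subst this
  omega

lemma lin_zero (k : ℕ) (hk : Squarefree k) (hk1 : 1 < k) (a b : ℤ)
    (h : (a : ℝ) + b * omg k = 0 ∨ (a : ℝ) + b * omg' k = 0) : a = 0 ∧ b = 0 := by
  have hirr := sqrt_irr k hk hk1
  have hb : b = 0 := by
    by_contra hb
    have hb' : (b : ℝ) ≠ 0 := by exact_mod_cast hb
    apply hirr
    obtain ⟨q, hq⟩ : ∃ q : ℤ, k0 k = q := by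
      unfold k0; split_ifs
      · exact ⟨2, by norm_num⟩
      · exact ⟨1, by norm_num⟩
    have hk0 : k0 k ≠ 0 := (k0_pos k).ne'
    unfold omg omg' at h
    rcases h with h | h
    · refine ⟨(-(a*q) - b)/b, ?_⟩
      push_cast
      rw [← hq]
      field_simp at h ⊢
      linarith
    · refine ⟨(a*q + b)/b, ?_⟩
      push_cast
      rw [← hq]
      field_simp at h ⊢
      linarith
  subst hb
  simp at h
  exact ⟨h, rfl⟩

lemma norm_ge (k : ℕ) (hk : Squarefree k) (hk1 : 1 < k) (g : ℝ × ℝ) (hg : g ∈ R k) (h0 : g ≠ 0) :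
    g.1 ≠ 0 ∧ g.2 ≠ 0 ∧ 1 ≤ (g.1 * g.2)^2 := by
  obtain ⟨a, b, rfl⟩ := (mem_R_iff k g).1 hg
  have hz : ¬ (a = 0 ∧ b = 0) := by
    rintro ⟨rfl, rfl⟩
    apply h0
    ext <;> simp
  have h1 : (a : ℝ) + b * omg k ≠ 0 := fun h => hz (lin_zero k hk hk1 a b (Or.inl h))
  have h2 : (a : ℝ) + b * omg' k ≠ 0 := fun h => hz (lin_zero k hk hk1 a b (Or.inr h))
  refine ⟨h1, h2, ?_⟩
  obtain ⟨t, n, -, -, h3, h4⟩ := omg_quad k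
  have e : ((a : ℝ) + b * omg k) * (a + b * omg' k) = ((a^2 + a*b*t - b^2*n : ℤ) : ℝ) := by
    push_cast
    linear_combination (a*b : ℝ) * h3 + (b^2 : ℝ) * h4
  have hne := mul_ne_zero h1 h2
  simp only
  rw [e] at hne ⊢
  have hne' : (a^2 + a*b*t - b^2*n : ℤ) ≠ 0 := by exact_mod_cast hne
  have : (1:ℤ) ≤ (a^2 + a*b*t - b^2*n : ℤ)^2 := by
    have := sq_pos_of_ne_zero hne'
    omega
  exact_mod_cast this

lemma HNorm_ge (k : ℕ) (hk : Squarefree k) (hk1 : 1 < k)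
    (hPID : IsPrincipalIdealRing (R k)) (p : Pt) (hp : p ∈ F0 k) (c d : R k) (h : c ≠ 0 ∨ d ≠ 0) :
    1 ≤ HNorm (c : ℝ × ℝ) (d : ℝ × ℝ) p := by
  obtain ⟨g, hg⟩ := (hPID.principal (Ideal.span {c, d})).principal
  have hcm : c ∈ Ideal.span {c, d} := Ideal.subset_span (by simp)
  have hdm : d ∈ Ideal.span {c, d} := Ideal.subset_span (by simp)
  have hgm : g ∈ Ideal.span {c, d} := by rw [hg]; exact Submodule.mem_span_singleton_self g
  obtain ⟨x, y, hxy⟩ := Ideal.mem_span_pair.1 hgm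
  rw [hg] at hcm hdm
  obtain ⟨c', hc⟩ := Submodule.mem_span_singleton.1 hcm
  obtain ⟨d', hd⟩ := Submodule.mem_span_singleton.1 hdm
  rw [smul_eq_mul] at hc hd
  have hg0 : g ≠ 0 := by
    rintro rfl
    rw [mul_zero] at hc hd
    rcases h with h | h
    · exact h hc.symm
    · exact h hd.symm
  obtain ⟨g1, g2, gn⟩ := norm_ge k hk hk1 g g.2 (fun h => hg0 (Subtype.ext h))
  have hone : x * c' + y * d' = 1 := by
    have e : (x * c' + y * d') * g = 1 * g := by
      rw [one_mul]; linear_combination hxy + x * hc + y * hd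
    have e' : ((x * c' + y * d' : R k) : ℝ × ℝ) * (g : ℝ × ℝ) = ((1 : R k) : ℝ × ℝ) * (g : ℝ × ℝ) :=
      congrArg Subtype.val e
    apply Subtype.ext
    apply Prod.ext
    · exact mul_right_cancel₀ g1 (congrArg Prod.fst e')
    · exact mul_right_cancel₀ g2 (congrArg Prod.snd e')
  have hS : (c', d') ∈ Spairs k := by
    change Ideal.span {c', d'} = ⊤
    rw [Ideal.eq_top_iff_one]
    exact Ideal.mem_span_pair.2 ⟨x, y, hone⟩
  have h1 := hp.2 _ hS
  have e : HNorm (c : ℝ × ℝ) (d : ℝ × ℝ) p =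
      ((g : ℝ × ℝ).1 * (g : ℝ × ℝ).2)^2 * HNorm (c' : ℝ × ℝ) (d' : ℝ × ℝ) p := by
    rw [← hc, ← hd]
    simp only [HNorm, Subring.coe_mul, Prod.fst_mul, Prod.snd_mul]
    ring
  rw [e]
  simp only at h1
  nlinarith

/-- rank two form attached to one embedding -/
def frm (l x y o : ℝ) : Matrix (Fin 3) (Fin 3) ℝ :=
  !![l*(x^2+y^2), l*x, l*(x*o); l*x, l, l*o; l*(x*o), l*o, l*o^2]

lemma frm_symm (l x y o : ℝ) : (frm l x y o)ᵀ = frm l x y o := by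
  ext i j; fin_cases i <;> fin_cases j <;> rfl

lemma frm_qm (l x y o : ℝ) (w : Fin 3 → ℤ) :
    qm (frm l x y o) w = l * ((w 0 * x + (w 1 + w 2 * o))^2 + (w 0 : ℝ)^2 * y^2) := by
  simp [qm, frm, dotProduct, Matrix.mulVec, Fin.sum_univ_three]
  ring

lemma bdd (l l' x x' y y' o o' : ℝ) (hl : 0 < l) (hl' : 0 < l') (hy : 0 < y) (ho : 0 < o - o') (C : ℝ) :
    ∃ N : ℤ, ∀ w, qm (frm l x y o + frm l' x' y' o') w ≤ C → ∀ i, |w i| ≤ N := by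
  obtain ⟨K, K1, k1, k2, k3⟩ : ∃ K : ℝ, 1 ≤ K ∧ C ≤ l * K ∧ C ≤ l' * K ∧ C ≤ l * y^2 * K := by
    refine ⟨1 + |C|/l + |C|/l' + |C|/(l*y^2), ?_, ?_, ?_, ?_⟩
    · have : 0 ≤ |C|/l + |C|/l' + |C|/(l*y^2) := by positivity
      linarith
    · have h1 : l * (|C|/l) = |C| := by field_simp
      have h2 : 0 ≤ l * (1 + |C|/l' + |C|/(l*y^2)) := by positivity
      have := le_abs_self C
      linarith
    · have h1 : l' * (|C|/l') = |C| := by field_simp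
      have h2 : 0 ≤ l' * (1 + |C|/l + |C|/(l*y^2)) := by positivity
      have := le_abs_self C
      linarith
    · have h1 : (l*y^2) * (|C|/(l*y^2)) = |C| := by field_simp
      have h2 : 0 ≤ (l*y^2) * (1 + |C|/l + |C|/l') := by positivity
      have := le_abs_self C
      linarith
  let Kb := (2*K + K*|x - x'|)/(o-o')
  let Ka := K + K*|x| + Kb * |o|
  obtain ⟨N, hN⟩ := exists_int_gt (K + Ka + Kb)
  have hKb : 0 ≤ Kb := by positivity
  have hKa : 0 ≤ Ka := by positivity
  refine ⟨N, fun w hw => ?_⟩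
  have e : qm (frm l x y o + frm l' x' y' o') w = qm (frm l x y o) w + qm (frm l' x' y' o') w := by
    simp [qm, Matrix.add_mulVec]
  rw [e, frm_qm, frm_qm] at hw
  set n : ℝ := (w 0 : ℝ) with hn
  set a : ℝ := (w 1 : ℝ) with ha
  set b : ℝ := (w 2 : ℝ) with hb
  set u : ℝ := n*x + (a + b*o) with hu
  set u' : ℝ := n*x' + (a + b*o') with hu'
  have p1 : 0 ≤ l * u^2 := by positivity
  have p2 : 0 ≤ l' * u'^2 := by positivity
  have p3 : 0 ≤ l * (n^2*y^2) := by positivity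
  have p4 : 0 ≤ l' * (n^2*y'^2) := by positivity
  have sqb : ∀ (v m : ℝ), 0 < m → m * v^2 ≤ m * K → |v| ≤ K := by
    intro v m hm h
    have : v^2 ≤ K := le_of_mul_le_mul_left h hm
    apply abs_le_of_sq_le_sq _ (by linarith)
    nlinarith
  have b1 : |u| ≤ K := sqb u l hl (by linarith)
  have b2 : |u'| ≤ K := sqb u' l' hl' (by linarith)
  have b3 : |n| ≤ K := sqb n (l*y^2) (by positivity) (by linarith)
  have b4 : |b| ≤ Kb := by
    rw [le_div_iff₀ ho]
    have e1 : b*(o-o') = u - u' - n*(x-x') := by rw [hu, hu']; ring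
    have e2 : |b| * (o-o') = |b*(o-o')| := by rw [abs_mul, abs_of_pos ho]
    rw [e2, e1]
    have t1 := abs_sub (u-u') (n*(x-x'))
    have t2 := abs_sub u u'
    rw [abs_mul] at t1
    have t3 : |n| * |x-x'| ≤ K*|x-x'| := mul_le_mul_of_nonneg_right b3 (abs_nonneg _)
    linarith
  have b5 : |a| ≤ Ka := by
    have e1 : a = u - n*x - b*o := by rw [hu]; ring
    rw [e1]
    have t1 := abs_sub (u-n*x) (b*o)
    have t2 := abs_sub u (n*x)
    rw [abs_mul] at t1 t2
    have t3 : |n| * |x| ≤ K*|x| := mul_le_mul_of_nonneg_right b3 (abs_nonneg _)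
    have t4 : |b| * |o| ≤ Kb*|o| := mul_le_mul_of_nonneg_right b4 (abs_nonneg _)
    simp only [Ka]
    linarith
  intro i
  have : |(w i : ℝ)| ≤ N := by
    fin_cases i
    · change |n| ≤ N; linarith
    · change |a| ≤ N; linarith
    · change |b| ≤ N; linarith
  exact_mod_cast this

/-- If `R` is a principal ideal domain and `(s₁,s₂,r,h) ∈ F₀`, then
`h > k₀²/(2k)`. -/
theorem height_gt_of_mem_F0 (k : ℕ) (hk : Squarefree k) (hk1 : 1 < k)
    (hPID : IsPrincipalIdealRing (R k)) :
    ∀ p ∈ F0 k, (k0 k) ^ 2 / (2 * k) < hh p := by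
  intro p hp
  by_contra hcon
  push Not at hcon
  have hy1 : 0 < y1 p := hp.1.1
  have hy2 : 0 < y2 p := hp.1.2
  have hk0 := k0_pos k
  have hkp : (0:ℝ) < k := by positivity
  have ho : 0 < omg k - omg' k := by rw [omg_sub]; positivity
  have hl : 0 < y2 p / y1 p := by positivity
  have hl' : 0 < y1 p / y2 p := by positivity
  have key := tern (frm (y2 p / y1 p) (x1 p) (y1 p) (omg k)) (frm (y1 p / y2 p) (x2 p) (y2 p) (omg' k))
    (frm_symm _ _ _ _) (frm_symm _ _ _ _)
    (by rw [Matrix.det_fin_three]; simp [frm]; ring)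
    (by
      intro w hw
      rw [frm_qm, frm_qm]
      refine ⟨by positivity, by positivity, ?_⟩
      let c : R k := (w 0 : R k)
      let d : R k := ⟨((w 1 : ℝ) + w 2 * omg k, (w 1 : ℝ) + w 2 * omg' k), (mem_R_iff k _).2 ⟨_, _, rfl⟩⟩
      have hc : (c : ℝ × ℝ) = ((w 0 : ℝ), (w 0 : ℝ)) := rfl
      have hd : (d : ℝ × ℝ) = ((w 1 : ℝ) + w 2 * omg k, (w 1 : ℝ) + w 2 * omg' k) := rfl
      have hne : c ≠ 0 ∨ d ≠ 0 := by
        by_contra hcd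
        push Not at hcd
        obtain ⟨hc0, hd0⟩ := hcd
        rw [hc0] at hc
        rw [hd0] at hd
        have h0 : (0:ℝ) = w 0 := congrArg Prod.fst hc
        have h1 : (0:ℝ) = (w 1 : ℝ) + w 2 * omg k := congrArg Prod.fst hd
        have h2 := lin_zero k hk hk1 _ _ (Or.inl h1.symm)
        apply hw
        ext i
        fin_cases i
        · exact_mod_cast h0.symm
        · exact h2.1
        · exact h2.2
      have h1 := HNorm_ge k hk hk1 hPID p hp c d hne
      rw [hc, hd] at h1
      simp only [HNorm] at h1
      refine h1.trans_eq ?_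
      field_simp)
    (bdd _ _ _ _ _ _ _ _ hl hl' hy1 ho)
  have hdet : (frm (y2 p / y1 p) (x1 p) (y1 p) (omg k) + frm (y1 p / y2 p) (x2 p) (y2 p) (omg' k)).det
      = (omg k - omg' k)^2 * (2 * (y1 p * y2 p)) := by
    rw [Matrix.det_fin_three]
    simp [frm]
    field_simp
    ring
  rw [hdet, omg_sub, div_pow, mul_pow, Real.sq_sqrt hkp.le] at key
  have h3 : (y1 p * y2 p) * (2 * k) ≤ k0 k ^ 2 := by
    rwa [hh, le_div_iff₀ (by positivity)] at hcon
  have h4 : 2 ^ 2 * (k:ℝ) / k0 k ^ 2 * (2 * (y1 p * y2 p)) ≤ 4 := by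
    rw [div_mul_eq_mul_div, div_le_iff₀ (by positivity)]
    linarith
  linarith

end Hilbert
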